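/- Let $f: B \to B$ be a continuous map of a topological space $B$ homeomorphic to an open ball in $\mathbb{R}^n$ (more generally, a connected topological $n$-manifold without boundary). If $f$ admits a continuous section $s: B \to B$ (i.e., $f \circ s = \mathrm{id}_B$) that is proper, then $s$ is a homeomorphism onto $B$, and consequently $f$ is injective. -/

import Mathlib

open Set Metric MeasureTheory

lemma aux_ext {E : Type*} [NormedAddCommGroup E] [NormedSpace ℝ E]
    (u : E → E) (R : ℝ) (C : NNReal) (hu : LipschitzOnWith C u (closedBall 0 R))
    (h0 : ∀ x, R ≤ ‖x‖ → u x = 0) : LipschitzWith C u := by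
  have key : ∀ x y : E, ‖x‖ ≤ R → R ≤ ‖y‖ → dist (u x) (u y) ≤ C * dist x y := by
    intro x y hx hy
    have hc : ContinuousOn (fun t : ℝ => ‖AffineMap.lineMap x y t‖) (Icc (0:ℝ) 1) := by
      apply Continuous.continuousOn
      exact (AffineMap.lineMap_continuous).norm
    obtain ⟨t, ht, hz⟩ := intermediate_value_Icc zero_le_one hc
      (show R ∈ Icc _ _ by simpa using ⟨hx, hy⟩)
    simp only at hz
    set z : E := AffineMap.lineMap x y t with hzd
    rw [h0 y hy, ← h0 z hz.ge]
    refine (hu.dist_le_mul x (by simpa using hx) z (by simpa using hz.le)).trans ?_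
    gcongr
    rw [hzd, dist_left_lineMap, Real.norm_of_nonneg ht.1]
    nlinarith [ht.2, dist_nonneg (x := x) (y := y)]
  apply LipschitzWith.of_dist_le_mul
  intro x y
  rcases le_total ‖x‖ R with hx | hx <;> rcases le_total ‖y‖ R with hy | hy
  · exact hu.dist_le_mul x (by simpa using hx) y (by simpa using hy)
  · exact key x y hx hy
  · rw [dist_comm, dist_comm x]; exact key y x hy hx
  · rw [h0 x hx, h0 y hy]; simp; positivity

lemma aux_bij {E : Type*} [NormedAddCommGroup E] [NormedSpace ℝ E] [CompleteSpace E]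
    (u : E → E) (C : NNReal) (hu : LipschitzWith C u) (t : ℝ) (ht : 0 ≤ t) (htC : t * C < 1) :
    Function.Bijective (fun x => x + t • u x) := by
  have hl : ∀ x y, dist (t • u x) (t • u y) ≤ t * C * dist x y := by
    intro x y
    rw [dist_smul₀, Real.norm_of_nonneg ht, mul_assoc]
    gcongr
    exact hu.dist_le_mul x y
  constructor
  · intro x y h
    simp only at h
    have h1 : dist x y = dist (t • u x) (t • u y) := by
      rw [dist_eq_norm, dist_eq_norm, ← norm_neg (t • u x - t • u y)]
      congr 1
      have := sub_eq_zero.2 h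
      rw [← sub_eq_zero, ← this]; abel
    have h2 := hl x y
    by_contra hne
    have := dist_pos.2 hne
    nlinarith
  · intro y
    have hc : ContractingWith (⟨t * C, by positivity⟩ : NNReal) (fun x => y - t • u x) := by
      refine ⟨by exact_mod_cast htC, LipschitzWith.of_dist_le_mul fun a b => ?_⟩
      rw [dist_sub_left]
      exact hl a b
    refine ⟨hc.fixedPoint, ?_⟩
    have := hc.fixedPoint_isFixedPt
    unfold Function.IsFixedPt at this
    simp only at this ⊢
    nth_rewrite 1 [← this]
    abel

lemma aux_lag (n : ℕ) (ε : ℝ) (hε : 0 < ε) : ∃ (v c : ℕ → ℝ),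
    (∀ i, 0 ≤ v i ∧ v i < ε) ∧ (∑ i ∈ Finset.range (n+1), c i = 1) ∧
    ∀ A : EuclideanSpace ℝ (Fin n) →L[ℝ] EuclideanSpace ℝ (Fin n),
      (1 + A).det = ∑ i ∈ Finset.range (n+1), c i * (1 + v i • A).det := by
  let v : ℕ → ℝ := fun i => ε / (i + 2)
  have hv : Function.Injective v := by
    intro i j h
    simp only [v] at h
    field_simp at h
    have : (j:ℝ) = i := by linarith
    exact_mod_cast this.symm
  refine ⟨v, fun i => (Lagrange.basis (Finset.range (n+1)) v i).eval 1, ?_, ?_, ?_⟩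
  · intro i
    refine ⟨by positivity, ?_⟩
    have : (0:ℝ) ≤ i := by positivity
    simp only [v]
    rw [div_lt_iff₀ (by positivity)]; nlinarith
  · rw [← Polynomial.eval_finsetSum, Lagrange.sum_basis hv.injOn (by simp)]; simp
  · intro A
    let M := LinearMap.toMatrix (EuclideanSpace.basisFun (Fin n) ℝ).toBasis
      (EuclideanSpace.basisFun (Fin n) ℝ).toBasis (A : _ →ₗ[ℝ] _)
    let p : Polynomial ℝ := Matrix.det ((Polynomial.X : Polynomial ℝ) • M.map Polynomial.C +
      (1 : Matrix (Fin n) (Fin n) ℝ).map Polynomial.C)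
    have hp : ∀ t : ℝ, (1 + t • A).det = p.eval t := by
      intro t
      simp only [p, ← Polynomial.coe_evalRingHom, RingHom.map_det]
      rw [ContinuousLinearMap.det, ← LinearMap.det_toMatrix (EuclideanSpace.basisFun (Fin n) ℝ).toBasis]
      congr 1
      have : ((1 + t • A : EuclideanSpace ℝ (Fin n) →L[ℝ] EuclideanSpace ℝ (Fin n)) : EuclideanSpace ℝ (Fin n) →ₗ[ℝ] EuclideanSpace ℝ (Fin n)) = LinearMap.id + t • (A : _ →ₗ[ℝ] _) := rfl
      rw [this, map_add, map_smul, LinearMap.toMatrix_id]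
      ext i j
      simp [M, Matrix.one_apply]
      split_ifs <;> simp <;> ring
    have hd : p.degree < (Finset.range (n+1)).card := by
      have := Polynomial.natDegree_det_X_add_C_le M 1
      rw [Finset.card_range]
      refine Polynomial.degree_le_natDegree.trans_lt ?_
      rw [Fintype.card_fin] at this
      exact_mod_cast Nat.lt_succ_of_le this
    have h1 := hp 1
    rw [one_smul] at h1
    rw [h1]
    conv_lhs => rw [Lagrange.eq_interpolate (s := Finset.range (n+1)) (v := v) hv.injOn hd]
    rw [Lagrange.interpolate_apply, Polynomial.eval_finsetSum]
    refine Finset.sum_congr rfl fun i _ => ?_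
    rw [hp]
    simp [mul_comm]

/-- `g` smooth with norm 2 everywhere, identity on the sphere: impossible. -/
lemma aux_noretract (n : ℕ) (g : EuclideanSpace ℝ (Fin n) → EuclideanSpace ℝ (Fin n))
    (hg : ContDiff ℝ 1 g) (hn : ∀ x, ‖g x‖ = 2) (hid : ∀ x, ‖x‖ = 2 → g x = x) : False := by
  classical
  let E := EuclideanSpace ℝ (Fin n)
  let u : E → E := fun x => if ‖x‖ < 2 then g x - x else 0
  have h0 : ∀ x, 2 ≤ ‖x‖ → u x = 0 := fun x hx => if_neg (not_lt.2 hx)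
  have hcl : ∀ x, ‖x‖ ≤ 2 → u x = g x - x := by
    intro x hx
    rcases hx.lt_or_eq with h | h
    · exact if_pos h
    · rw [h0 x h.ge, hid x h, sub_self]
  have hgu : ContDiff ℝ 1 (fun x => g x - x) := hg.sub contDiff_id
  obtain ⟨C, hC⟩ : ∃ C : NNReal, LipschitzWith C u := by
    have hcont : Continuous (fderiv ℝ (fun x => g x - x)) := hgu.continuous_fderiv (by simp)
    obtain ⟨C, hC⟩ := (isCompact_closedBall (0:E) 2).exists_bound_of_continuousOn hcont.continuousOn
    refine ⟨C.toNNReal, aux_ext u 2 _ ?_ h0⟩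
    have := (convex_closedBall (0:E) 2).lipschitzOnWith_of_nnnorm_fderiv_le (𝕜 := ℝ)
      (f := fun x => g x - x) (C := C.toNNReal)
      (fun x _ => (hgu.differentiable (by simp)).differentiableAt)
      (fun x hx => by
        rw [← NNReal.coe_le_coe]
        exact (hC x hx).trans (Real.le_coe_toNNReal C))
    intro x hx y hy
    rw [hcl x (by simpa using hx), hcl y (by simpa using hy)]
    exact this hx hy
  let A : E → E →L[ℝ] E := fun x => fderiv ℝ u x
  have hdiff : ∀ x ∈ ball (0:E) 2, HasFDerivAt u (A x) x ∧ HasFDerivAt g (1 + A x) x := by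
    intro x hx
    have he : u =ᶠ[nhds x] fun x => g x - x := by
      filter_upwards [isOpen_ball.mem_nhds hx] with y hy
      exact hcl y (by simpa using (mem_ball_zero_iff.1 hy).le)
    have h1 : HasFDerivAt u (A x) x :=
      (((hgu.differentiable (by simp)).differentiableAt).congr_of_eventuallyEq he).hasFDerivAt
    refine ⟨h1, ?_⟩
    have h2 := (h1.congr_of_eventuallyEq he.symm).add (hasFDerivAt_id x)
    have h3 : HasFDerivAt g (A x + ContinuousLinearMap.id ℝ E) x :=
      h2.congr_of_eventuallyEq (by filter_upwards with y; simp)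
    rw [add_comm]; exact h3
  have hA : ∀ x, ‖A x‖ ≤ C := fun x => norm_fderiv_le_of_lipschitz ℝ hC
  have hdet0 : ∀ x ∈ ball (0:E) 2, (1 + A x).det = 0 := by
    intro x hx
    by_contra hne
    have h1 := (hdiff x hx).2
    have h2 : HasFDerivAt (fun y => ‖g y‖ ^ 2) (0 : E →L[ℝ] ℝ) x := by
      simp only [hn]; exact hasFDerivAt_const _ _
    have h3 := h2.unique h1.norm_sq
    have hs : Function.Surjective ((1 + A x : E →L[ℝ] E) : E → E) := by
      have := (LinearMap.equivOfDetNeZero ((1 + A x : E →L[ℝ] E) : E →ₗ[ℝ] E) hne).surjective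
      exact this
    obtain ⟨v, hv⟩ := hs (g x)
    have h4 := congrArg (fun L => L v) h3
    simp only [smul_apply, ContinuousLinearMap.comp_apply,
      zero_apply, hv, innerSL_apply_apply, real_inner_self_eq_norm_sq, hn] at h4
    norm_num at h4
  -- positivity of det near 1
  obtain ⟨η, hη, hpos⟩ : ∃ η > 0, ∀ L : E →L[ℝ] E, ‖L‖ < η → 0 < (1 + L).det := by
    have hc : Continuous (fun L : E →L[ℝ] E => (1 + L).det) :=
      ContinuousLinearMap.continuous_det.comp (continuous_const.add continuous_id)
    have : ∀ᶠ L in nhds (0 : E →L[ℝ] E), 0 < (1 + L).det := by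
      apply hc.continuousAt.eventually_const_lt
      have h1 : (1 : E →L[ℝ] E).det = 1 := LinearMap.det_id
      simp only [add_zero, h1]
      exact one_pos
    obtain ⟨η, hη, h⟩ := Metric.eventually_nhds_iff.1 this
    exact ⟨η, hη, fun L hL => h (by simpa using hL)⟩
  obtain ⟨v, c, hv, hc1, hlag⟩ := aux_lag n (min η 1 / (C + 1)) (by positivity)
  have hint : ∀ i, IntegrableOn (fun x => (1 + v i • A x).det) (ball (0:E) 2) volume ∧
      ∫ x in ball (0:E) 2, (1 + v i • A x).det = volume.real (ball (0:E) 2) := by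
    intro i
    obtain ⟨hv0, hv1⟩ := hv i
    rw [lt_div_iff₀ (by positivity)] at hv1
    have hbij := aux_bij u C hC (v i) hv0 (by
      have := min_le_right η 1
      nlinarith)
    have himg : (fun x => x + v i • u x) '' ball (0:E) 2 = ball (0:E) 2 := by
      have hout : ∀ x, 2 ≤ ‖x‖ → x + v i • u x = x := by
        intro x hx; rw [h0 x hx]; simp
      ext y
      simp only [mem_image, mem_ball_zero_iff]
      constructor
      · rintro ⟨x, hx, rfl⟩
        by_contra hge
        rw [not_lt] at hge
        have := hbij.1 (hout _ hge)
        simp only at this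
        rw [this] at hge
        linarith
      · intro hy
        obtain ⟨x, hx⟩ := hbij.2 y
        refine ⟨x, ?_, hx⟩
        by_contra hge
        rw [not_lt] at hge
        simp only [hout x hge] at hx
        rw [hx] at hge
        linarith
    have hd : ∀ x ∈ ball (0:E) 2, HasFDerivWithinAt (fun x => x + v i • u x) (1 + v i • A x)
        (ball (0:E) 2) x := by
      intro x hx
      exact ((hasFDerivAt_id x).add ((hdiff x hx).1.const_smul (v i))).hasFDerivWithinAt
    have hp : ∀ x, 0 < (1 + v i • A x).det := by
      intro x
      apply hpos
      rw [norm_smul, Real.norm_of_nonneg hv0]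
      have := min_le_left η 1
      nlinarith [hA x]
    have hl := lintegral_abs_det_fderiv_eq_addHaar_image volume measurableSet_ball hd hbij.1.injOn
    rw [himg] at hl
    have habs : ∀ x, |(1 + v i • A x).det| = (1 + v i • A x).det := fun x => abs_of_pos (hp x)
    simp only [habs] at hl
    have hmeas : Measurable (fun x => (1 + v i • A x).det) := by
      apply ContinuousLinearMap.continuous_det.measurable.comp
      exact ((measurable_fderiv ℝ u).const_smul (v i)).const_add 1
    constructor
    · refine ⟨hmeas.aestronglyMeasurable, ?_⟩
      rw [hasFiniteIntegral_iff_ofReal (Filter.Eventually.of_forall fun x => (hp x).le), hl]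
      exact measure_ball_lt_top
    · rw [integral_eq_lintegral_of_nonneg_ae (Filter.Eventually.of_forall fun x => (hp x).le)
        hmeas.aestronglyMeasurable, hl]
      rfl
  have hfin : ∫ x in ball (0:E) 2, (1 + A x).det = volume.real (ball (0:E) 2) := by
    rw [integral_congr_ae (Filter.Eventually.of_forall fun x => hlag (A x))]
    rw [integral_finsetSum _ (fun i _ => ((hint i).1.const_mul (c i)))]
    simp_rw [integral_const_mul, (hint _).2]
    rw [← Finset.sum_mul, hc1, one_mul]
  rw [setIntegral_congr_fun measurableSet_ball (g := fun _ => 0) (fun x hx => hdet0 x hx)] at hfin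
  simp only [integral_zero] at hfin
  have : 0 < volume.real (ball (0:E) 2) :=
    ENNReal.toReal_pos (measure_ball_pos volume 0 (by norm_num)).ne' measure_ball_lt_top.ne
  linarith

/-- A continuous map close to the identity on the ball of radius 2 has a zero. -/
lemma aux_zero (n : ℕ) (w : EuclideanSpace ℝ (Fin n) → EuclideanSpace ℝ (Fin n))
    (hw : Continuous w) (hc : ∀ x, ‖x‖ ≤ 2 → ‖w x - x‖ < 1 / 2)
    (hne : ∀ x, ‖x‖ ≤ 2 → w x ≠ 0) : False := by
  let E := EuclideanSpace ℝ (Fin n)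
  obtain ⟨x0, hx0, hmin⟩ := (isCompact_closedBall (0:E) 2).exists_isMinOn
    ⟨0, by simp⟩ hw.norm.continuousOn
  have hε : 0 < ‖w x0‖ := norm_pos_iff.2 (hne x0 (by simpa using hx0))
  obtain ⟨v, hv, hvw, -⟩ := hw.exists_contDiff_approx 1 (ε := fun _ => min ‖w x0‖ (1/2))
    continuous_const (fun _ => by positivity)
  have hvne : ∀ x, ‖x‖ ≤ 2 → v x ≠ 0 := by
    intro x hx h
    have h1 := (hvw x).trans_le (min_le_left _ _)
    rw [h, dist_zero_left] at h1
    have := hmin (show x ∈ closedBall (0:E) 2 by simpa using hx)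
    simp only [mem_ofPred_eq] at this
    linarith
  have hvc : ∀ x, ‖x‖ ≤ 2 → ‖v x - x‖ < 1 := by
    intro x hx
    have h1 := (hvw x).trans_le (min_le_right _ _)
    rw [dist_eq_norm] at h1
    have h2 := norm_add_le (v x - w x) (w x - x)
    rw [sub_add_sub_cancel] at h2
    linarith [hc x hx]
  let b : ContDiffBump (0:E) := ⟨1, 2, by norm_num, by norm_num⟩
  let k : E → E := fun x => x + b x • (v x - x)
  have hk : ContDiff ℝ 1 k := contDiff_id.add (b.contDiff.smul (hv.sub contDiff_id))
  have hkid : ∀ x, 2 ≤ ‖x‖ → k x = x := by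
    intro x hx
    have : b x = 0 := b.zero_of_le_dist (by simpa using hx)
    simp [k, this]
  have hk0 : ∀ x, k x ≠ 0 := by
    intro x h
    rcases le_or_gt 2 ‖x‖ with h2 | h2
    · rw [hkid x h2] at h
      rw [h, norm_zero] at h2
      linarith
    rcases le_or_gt ‖x‖ 1 with h1 | h1
    · have : b x = 1 := b.one_of_mem_closedBall (by simpa using h1)
      simp only [k, this, one_smul, add_sub_cancel] at h
      exact hvne x h2.le h
    · have hx : x = -(b x • (v x - x)) := eq_neg_of_add_eq_zero_left h
      have : ‖x‖ = b x * ‖v x - x‖ := by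
        conv_lhs => rw [hx]
        rw [norm_neg, norm_smul, Real.norm_of_nonneg b.nonneg]
      have h3 := hvc x h2.le
      have h4 := b.le_one (x := x)
      have h5 := b.nonneg (x := x)
      nlinarith [norm_nonneg (v x - x)]
  refine aux_noretract n (fun x => (2 * ‖k x‖⁻¹) • k x) ?_ ?_ ?_
  · exact (contDiff_const.mul ((hk.norm ℝ hk0).inv (fun x => norm_ne_zero_iff.2 (hk0 x)))).smul hk
  · intro x
    have := norm_pos_iff.2 (hk0 x)
    rw [norm_smul, Real.norm_of_nonneg (by positivity)]
    field_simp
  · intro x hx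
    simp only [hkid x hx.ge, hx]
    norm_num

lemma aux_tao (n : ℕ) (f s : EuclideanSpace ℝ (Fin n) → EuclideanSpace ℝ (Fin n))
    (hf : Continuous f) (hs : Continuous s) (hfs : ∀ x, f (s x) = x)
    (δ : ℝ) (hδ : 0 < δ) (h0 : ∀ x, s x ≠ 0) (hs0 : ‖s 0‖ < δ)
    (hfδ : ∀ y, ‖y‖ ≤ δ → ‖f y‖ ≤ 1 / 10) : False := by
  let E := EuclideanSpace ℝ (Fin n)
  have hcomp : IsCompact (s '' closedBall (0:E) 2 ∩ {y | δ ≤ ‖y‖}) :=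
    ((isCompact_closedBall (0:E) 2).image hs).inter_right
      (isClosed_le continuous_const continuous_norm)
  obtain ⟨ε, hε, hεf⟩ : ∃ ε > 0, ∀ y ∈ s '' closedBall (0:E) 2 ∩ {y | δ ≤ ‖y‖}, ε ≤ ‖f y‖ := by
    rcases (s '' closedBall (0:E) 2 ∩ {y | δ ≤ ‖y‖}).eq_empty_or_nonempty with he | hne
    · exact ⟨1, one_pos, by simp [he]⟩
    · obtain ⟨y0, hy0, hmin⟩ := hcomp.exists_isMinOn hne hf.norm.continuousOn
      refine ⟨‖f y0‖, norm_pos_iff.2 ?_, fun y hy => hmin hy⟩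
      obtain ⟨⟨x, hx, rfl⟩, hy⟩ := hy0
      rw [hfs]
      rintro rfl
      exact absurd hs0 (not_lt.2 hy)
  set η := min ε (1/10) / 2 with hη
  have hηpos : 0 < η := by positivity
  have hη1 : 2 * η ≤ ε := by rw [hη]; linarith [min_le_left ε (1/10)]
  have hη2 : 2 * η ≤ 1/10 := by rw [hη]; linarith [min_le_right ε (1/10)]
  obtain ⟨P, hP, hPf, -⟩ := hf.exists_contDiff_approx 1 (ε := fun _ => η)
    continuous_const (fun _ => hηpos)
  obtain ⟨e, heη, heS⟩ : ∃ e ∈ ball (0:E) η, e ∉ P '' sphere (0:E) δ := by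
    by_contra! h
    have hnull : volume (P '' sphere (0:E) δ) = 0 :=
      addHaar_image_eq_zero_of_differentiableOn_of_addHaar_eq_zero volume
        (hP.differentiable (by simp)).differentiableOn
        (Measure.addHaar_sphere_of_ne_zero volume 0 hδ.ne')
    exact (measure_ball_pos volume (0:E) hηpos).ne' (measure_mono_null h hnull)
  rw [mem_ball_zero_iff] at heη
  have hQ : ∀ y, ‖(P y - e) - f y‖ < 2 * η := by
    intro y
    have h1 := hPf y
    rw [dist_eq_norm] at h1
    have h2 := norm_sub_le (P y - f y) e
    rw [sub_right_comm]
    linarith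
  let Φ : E → E := fun y => (max (δ * ‖y‖⁻¹) 1) • y
  have hΦ1 : ∀ y, δ ≤ ‖y‖ → Φ y = y := by
    intro y hy
    have hy0 : 0 < ‖y‖ := hδ.trans_le hy
    have : δ * ‖y‖⁻¹ ≤ 1 := by rw [← div_eq_mul_inv, div_le_one hy0]; exact hy
    simp [Φ, max_eq_right this]
  have hΦ2 : ∀ y, y ≠ 0 → ‖y‖ < δ → ‖Φ y‖ = δ := by
    intro y hy0 hy
    have hy0 : 0 < ‖y‖ := norm_pos_iff.2 hy0
    have : 1 ≤ δ * ‖y‖⁻¹ := by rw [← div_eq_mul_inv, one_le_div hy0]; exact hy.le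
    simp only [Φ, max_eq_left this]
    rw [norm_smul, Real.norm_of_nonneg (by positivity)]
    field_simp
  refine aux_zero n (fun x => P (Φ (s x)) - e) ?_ ?_ ?_
  · have : Continuous (fun x => Φ (s x)) :=
      ((continuous_const.mul (hs.norm.inv₀ fun x => norm_ne_zero_iff.2 (h0 x))).max
        continuous_const).smul hs
    exact (hP.continuous.comp this).sub continuous_const
  · intro x _
    rcases le_or_gt δ ‖s x‖ with h | h
    · simp only [hΦ1 _ h]
      have := hQ (s x)
      rw [hfs] at this
      linarith
    · have h1 := hfδ _ (hΦ2 _ (h0 x) h).le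
      have h2 := hfδ _ h.le
      rw [hfs] at h2
      have h3 := hQ (Φ (s x))
      have h4 := norm_add_le ((P (Φ (s x)) - e) - f (Φ (s x))) (f (Φ (s x)))
      rw [sub_add_cancel] at h4
      have h5 := norm_sub_le (P (Φ (s x)) - e) x
      linarith
  · intro x hx h
    rcases le_or_gt δ ‖s x‖ with h' | h'
    · simp only [hΦ1 _ h'] at h
      have h1 := hQ (s x)
      rw [h, zero_sub, norm_neg] at h1
      have h2 := hεf (s x) ⟨⟨x, by simpa using hx, rfl⟩, h'⟩
      linarith
    · exact heS ⟨Φ (s x), by simpa using hΦ2 _ (h0 x) h', sub_eq_zero.1 h⟩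

lemma aux_surj (n : ℕ) (f s : EuclideanSpace ℝ (Fin n) → EuclideanSpace ℝ (Fin n))
    (hf : Continuous f) (hs : Continuous s) (hfs : ∀ x, f (s x) = x)
    (hcl : IsClosed (range s)) : Function.Surjective s := by
  rw [← range_eq_univ]
  refine IsClopen.eq_univ ⟨hcl, ?_⟩ (range_nonempty s)
  rw [← interior_eq_iff_isOpen]
  refine interior_subset.antisymm ?_
  rintro _ ⟨x0, rfl⟩
  by_contra hni
  obtain ⟨r, hr, hball⟩ := Metric.continuousAt_iff.1 (hf.continuousAt (x := s x0)) (1/10)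
    (by norm_num)
  rw [hfs] at hball
  obtain ⟨c, hc, hcs⟩ : ∃ c, dist c (s x0) < r / 2 ∧ c ∉ range s := by
    by_contra! h
    exact hni (mem_interior_iff_mem_nhds.2 (Metric.mem_nhds_iff.2 ⟨r / 2, by positivity, h⟩))
  refine aux_tao n (fun y => f (y + c) - x0) (fun x => s (x + x0) - c) (by fun_prop) (by fun_prop)
    (by intro x; simp [hfs]) (r / 2) (by positivity) ?_ ?_ ?_
  · intro x hx
    exact hcs ⟨_, sub_eq_zero.1 hx⟩
  · simpa [dist_comm, ← dist_eq_norm] using hc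
  · intro y hy
    have h1 : dist (y + c) (s x0) < r := by
      have := dist_triangle (y + c) c (s x0)
      rw [dist_eq_norm (y + c) c, add_sub_cancel_right] at this
      linarith
    rw [← dist_eq_norm]
    exact (hball h1).le

theorem stmt14 (n : ℕ) (B : Type*) [TopologicalSpace B]
    (hB : Nonempty (B ≃ₜ (Metric.ball (0 : EuclideanSpace ℝ (Fin n)) 1)))
    (f s : B → B) (hf : Continuous f) (hs : Continuous s)
    (hps : IsProperMap s) (hsec : f ∘ s = id) :
    IsHomeomorph s ∧ Function.Injective f := by
  obtain ⟨φ0⟩ := hB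
  let φ : B ≃ₜ EuclideanSpace ℝ (Fin n) := φ0.trans Homeomorph.unitBall.symm
  have hfs : ∀ x, f (s x) = x := fun x => congrFun hsec x
  have hsurj : Function.Surjective s := by
    have h := aux_surj n (φ ∘ f ∘ φ.symm) (φ ∘ s ∘ φ.symm)
      (φ.continuous.comp (hf.comp φ.symm.continuous))
      (φ.continuous.comp (hs.comp φ.symm.continuous)) (by intro x; simp [hfs])
      (φ.isClosedMap.comp (hps.isClosedMap.comp φ.symm.isClosedMap)).isClosed_range
    intro y
    obtain ⟨x, hx⟩ := h (φ y)
    exact ⟨φ.symm x, φ.injective hx⟩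
  have hinj : Function.Injective s := Function.LeftInverse.injective hfs
  refine ⟨isHomeomorph_iff_continuous_isClosedMap_bijective.2
    ⟨hs, hps.isClosedMap, hinj, hsurj⟩, ?_⟩
  intro a b hab
  obtain ⟨x, rfl⟩ := hsurj a
  obtain ⟨y, rfl⟩ := hsurj b
  rw [hfs, hfs] at hab
  rw [hab]
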